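/- arXiv:2303.03741 — 4 statements merged into one kernel-verified Lean document; each statement's English description precedes it below -/
import Mathlib

section
/- For any matroid M on the finite ground set [n], its rank function rk_M : 2^{[n]} → ℝ_{≥0} is a strongly 2-coverage set function. -/
open MvPolynomial

/-- The directional derivative `D_a p = ∑ i, a i * ∂_{z i} p`. -/
noncomputable def dirDeriv {n : ℕ} (a : Fin n → ℝ) (p : MvPolynomial (Fin n) ℝ) :
    MvPolynomial (Fin n) ℝ :=
  ∑ i : Fin n, MvPolynomial.C (a i) * MvPolynomial.pderiv i p

/-- Iterated directional derivatives `D_{a₁} ⋯ D_{a_k} p`. -/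
noncomputable def dirDerivs {n : ℕ} (as : List (Fin n → ℝ)) (p : MvPolynomial (Fin n) ℝ) :
    MvPolynomial (Fin n) ℝ :=
  as.foldr dirDeriv p

/-- `p` is nonnegative on the nonnegative orthant and `log p` is concave there
(`x ^ t` denotes the real power `rpow`). -/
def LogConcaveOn {n : ℕ} (p : MvPolynomial (Fin n) ℝ) : Prop :=
  (∀ x : Fin n → ℝ, (∀ i, 0 ≤ x i) → 0 ≤ MvPolynomial.eval x p) ∧
    ∀ x y : Fin n → ℝ, (∀ i, 0 ≤ x i) → (∀ i, 0 ≤ y i) → ∀ t : ℝ, 0 ≤ t → t ≤ 1 →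
      MvPolynomial.eval x p ^ t * MvPolynomial.eval y p ^ (1 - t) ≤
        MvPolynomial.eval (fun i => t * x i + (1 - t) * y i) p

/-- `p` is completely log-concave. -/
def CompletelyLogConcave {n : ℕ} (p : MvPolynomial (Fin n) ℝ) : Prop :=
  ∀ as : List (Fin n → ℝ), (∀ a ∈ as, ∀ i, 0 ≤ a i) → LogConcaveOn (dirDerivs as p)

/-- Generating polynomial of a set function. -/
noncomputable def genPoly {n : ℕ} (f : Finset (Fin n) → ℝ) : MvPolynomial (Fin n) ℝ :=
  ∑ S : Finset (Fin n), MvPolynomial.C (f S) * ∏ i ∈ S, MvPolynomial.X i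

/-- Generating polynomial of a set function restricted to subsets of `V`. -/
noncomputable def genPolyOn {n : ℕ} (V : Finset (Fin n)) (f : Finset (Fin n) → ℝ) :
    MvPolynomial (Fin n) ℝ :=
  ∑ S ∈ V.powerset, MvPolynomial.C (f S) * ∏ i ∈ S, MvPolynomial.X i

/-- The `d`-homogeneous restriction `f^{(d)}` of a set function. -/
def homRestrict {n : ℕ} (f : Finset (Fin n) → ℝ) (d : ℕ) : Finset (Fin n) → ℝ :=
  fun S => if S.card = d then f S else 0

/-- `g` is a coverage function on subsets of `V`. -/
def IsCoverageOn {n : ℕ} (V : Finset (Fin n)) (g : Finset (Fin n) → ℝ) : Prop :=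
  ∃ (m : ℕ) (w : Fin m → ℝ) (A : Fin n → Finset (Fin m)),
    (∀ u, 0 ≤ w u) ∧ ∀ T ⊆ V, g T = ∑ u ∈ T.biUnion A, w u

/-- `ℓ` is a (nonnegative) linear set function on subsets of `V`. -/
def IsLinearOn {n : ℕ} (V : Finset (Fin n)) (ℓ : Finset (Fin n) → ℝ) : Prop :=
  (∀ i ∈ V, 0 ≤ ℓ {i}) ∧ ∀ T ⊆ V, ℓ T = ∑ i ∈ T, ℓ {i}

/-- `p` cannot be written as a sum of two nonzero polynomials in disjoint sets of variables. -/
def Indecomposable {n : ℕ} (p : MvPolynomial (Fin n) ℝ) : Prop :=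
  ¬ ∃ q r : MvPolynomial (Fin n) ℝ, q ≠ 0 ∧ r ≠ 0 ∧ Disjoint q.vars r.vars ∧ p = q + r

/-- `f` is 2-coverage with respect to `d`. -/
def TwoCoverageWrt {n : ℕ} (f : Finset (Fin n) → ℝ) (d : ℕ) : Prop :=
  (∀ τ : Finset (Fin n), τ.card ≤ d - 2 →
      Indecomposable (genPolyOn (Finset.univ \ τ) fun S => homRestrict f d (τ ∪ S))) ∧
  (∀ τ : Finset (Fin n), τ.card = d - 2 →
      ∃ V : Finset (Fin n), V ⊆ Finset.univ \ τ ∧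
        ∃ g ℓ : Finset (Fin n) → ℝ,
          IsCoverageOn V g ∧ IsLinearOn V ℓ ∧ (∀ i ∈ V, ℓ {i} ≤ g {i}) ∧
          ∀ T ⊆ Finset.univ \ τ, T.card = 2 →
            f (τ ∪ T) = if T ⊆ V then g T - ℓ T / 2 else 0)

/-- `f` is strongly 2-coverage. -/
def StronglyTwoCoverage {n : ℕ} (f : Finset (Fin n) → ℝ) : Prop :=
  ∀ τ : Finset (Fin n), τ.card ≤ n - 2 →
    ∃ g : Finset (Fin n) → ℝ, IsCoverageOn (Finset.univ \ τ) g ∧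
      ∀ S ⊆ Finset.univ \ τ, S.Nonempty → S.card ≤ 2 → f (τ ∪ S) = g S + f τ

/-- Monotone set function. -/
def MonotoneSet {n : ℕ} (f : Finset (Fin n) → ℝ) : Prop :=
  ∀ ⦃A B : Finset (Fin n)⦄, A ⊆ B → f A ≤ f B

/-- Submodular set function (diminishing returns). -/
def SubmodularSet {n : ℕ} (f : Finset (Fin n) → ℝ) : Prop :=
  ∀ ⦃S T : Finset (Fin n)⦄, S ⊆ T → ∀ i : Fin n,
    f (insert i T) - f T ≤ f (insert i S) - f S

/-- `levelSum f i = ∑_{|S| = i} f S`. -/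
noncomputable def levelSum {n : ℕ} (f : Finset (Fin n) → ℝ) (i : ℕ) : ℝ :=
  ∑ S ∈ Finset.powersetCard i (Finset.univ : Finset (Fin n)), f S

/-- A matroid on ground set `Fin n`, given by its independent sets. -/
structure FinMatroid (n : ℕ) where
  Indep : Finset (Fin n) → Prop
  indep_empty : Indep ∅
  indep_subset : ∀ ⦃S T : Finset (Fin n)⦄, Indep T → S ⊆ T → Indep S
  indep_exchange : ∀ ⦃S T : Finset (Fin n)⦄, Indep S → Indep T → S.card < T.card →
    ∃ i ∈ T, i ∉ S ∧ Indep (insert i S)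

open Classical in
/-- The rank of `S`: the maximum cardinality of an independent subset of `S`. -/
noncomputable def FinMatroid.rank {n : ℕ} (M : FinMatroid n) (S : Finset (Fin n)) : ℕ :=
  (S.powerset.filter fun T => M.Indep T).sup Finset.card

namespace FinMatroid

variable {n : ℕ} (M : FinMatroid n)

theorem card_le_rank {I S : Finset (Fin n)} (hI : M.Indep I) (hIS : I ⊆ S) :
    I.card ≤ M.rank S := by
  classical
  unfold rank
  exact Finset.le_sup (f := Finset.card) (by simp [hI, hIS])

theorem exists_indep_card_eq_rank (S : Finset (Fin n)) :
    ∃ I ⊆ S, M.Indep I ∧ I.card = M.rank S := by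
  classical
  obtain ⟨I, hI, h⟩ := Finset.exists_mem_eq_sup (S.powerset.filter fun T => M.Indep T)
    ⟨∅, by simp [M.indep_empty]⟩ Finset.card
  rw [Finset.mem_filter, Finset.mem_powerset] at hI
  refine ⟨I, hI.1, hI.2, ?_⟩
  unfold rank
  rw [← h]

theorem rank_mono {S T : Finset (Fin n)} (h : S ⊆ T) : M.rank S ≤ M.rank T := by
  obtain ⟨I, hIS, hI, hc⟩ := M.exists_indep_card_eq_rank S
  exact hc ▸ M.card_le_rank hI (hIS.trans h)

theorem rank_insert_le (S : Finset (Fin n)) (k : Fin n) :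
    M.rank (insert k S) ≤ M.rank S + 1 := by
  obtain ⟨I, hIS, hI, hc⟩ := M.exists_indep_card_eq_rank (insert k S)
  have h₁ := M.card_le_rank (M.indep_subset hI (Finset.erase_subset k I))
    (Finset.subset_insert_iff.mp hIS)
  have h₂ := Finset.pred_card_le_card_erase (s := I) (a := k)
  omega

/-- An independent subset of `S` extends to an independent subset of `S` of maximum size. -/
theorem exists_superset_card_eq_rank {I S : Finset (Fin n)} (hI : M.Indep I) (hIS : I ⊆ S) :
    ∃ J, I ⊆ J ∧ J ⊆ S ∧ M.Indep J ∧ J.card = M.rank S := by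
  classical
  obtain ⟨J, hJ, hmax⟩ := Finset.exists_max_image
    (S.powerset.filter fun T => M.Indep T ∧ I ⊆ T) Finset.card ⟨I, by simp [hI, hIS]⟩
  simp only [Finset.mem_filter, Finset.mem_powerset] at hJ hmax
  refine ⟨J, hJ.2.2, hJ.1, hJ.2.1, (M.card_le_rank hJ.2.1 hJ.1).antisymm ?_⟩
  by_contra! hlt
  obtain ⟨K, hKS, hK, hc⟩ := M.exists_indep_card_eq_rank S
  obtain ⟨i, hiK, hiJ, hi⟩ := M.indep_exchange hJ.2.1 hK (hc ▸ hlt)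
  have := hmax (insert i J) ⟨Finset.insert_subset (hKS hiK) hJ.1, hi,
    hJ.2.2.trans (Finset.subset_insert i J)⟩
  rw [Finset.card_insert_of_notMem hiJ] at this
  omega

theorem rank_insert_eq_of_subset {S T : Finset (Fin n)} (hST : S ⊆ T) {k : Fin n}
    (h : M.rank (insert k S) = M.rank S) : M.rank (insert k T) = M.rank T := by
  refine le_antisymm ?_ (M.rank_mono (Finset.subset_insert k T))
  by_contra! hlt
  obtain ⟨I, hIS, hI, hIc⟩ := M.exists_indep_card_eq_rank S
  obtain ⟨J, hIJ, hJT, hJ, hJc⟩ := M.exists_superset_card_eq_rank hI (hIS.trans hST)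
  obtain ⟨K, hKT, hK, hKc⟩ := M.exists_indep_card_eq_rank (insert k T)
  obtain ⟨i, hiK, hiJ, hi⟩ := M.indep_exchange hJ hK (by omega)
  rcases Finset.mem_insert.mp (hKT hiK) with rfl | hiT
  · have := M.card_le_rank (M.indep_subset hi (Finset.insert_subset_insert i hIJ))
      (Finset.insert_subset_insert i hIS)
    rw [Finset.card_insert_of_notMem fun hiI => hiJ (hIJ hiI)] at this
    omega
  · have := M.card_le_rank hi (Finset.insert_subset hiT hJT)
    rw [Finset.card_insert_of_notMem hiJ] at this
    omega

/-- The closure (flat spanned by) `S`. -/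
noncomputable def closure (S : Finset (Fin n)) : Finset (Fin n) :=
  Finset.univ.filter fun k => M.rank (insert k S) = M.rank S

theorem mem_closure {S : Finset (Fin n)} {k : Fin n} :
    k ∈ M.closure S ↔ M.rank (insert k S) = M.rank S := by
  simp [closure]

theorem closure_eq_of_subset {S T : Finset (Fin n)} (hST : S ⊆ T) (h : M.rank T = M.rank S) :
    M.closure S = M.closure T := by
  ext k
  rw [mem_closure, mem_closure]
  refine ⟨M.rank_insert_eq_of_subset hST, fun hk => ?_⟩
  have h₁ := M.rank_mono (Finset.insert_subset_insert k hST)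
  have h₂ := M.rank_mono (Finset.subset_insert k S)
  omega

/-- Two non-loops over `S` are parallel iff they span the same flat together with `S`. -/
theorem closure_insert_eq_iff {S : Finset (Fin n)} {i j : Fin n}
    (h : M.rank (insert i S) = M.rank (insert j S)) :
    M.closure (insert i S) = M.closure (insert j S) ↔
      M.rank (insert i (insert j S)) = M.rank (insert j S) := by
  constructor
  · intro hc
    rw [← mem_closure, ← hc, mem_closure, Finset.insert_idem]
  · intro hr
    rw [M.closure_eq_of_subset (Finset.subset_insert i (insert j S)) hr]
    refine M.closure_eq_of_subset ?_ (hr.trans h.symm)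
    exact Finset.insert_subset_insert i (Finset.subset_insert j S)

/-- The flats of rank one in the contraction `M / S` spanned by `i`: none if `i` is a loop there,
otherwise the parallel class of `i`. -/
noncomputable def parallelClass (S : Finset (Fin n)) (i : Fin n) : Finset (Finset (Fin n)) :=
  if M.rank (insert i S) = M.rank S then ∅ else {M.closure (insert i S)}

theorem card_parallelClass_add_rank (S : Finset (Fin n)) (i : Fin n) :
    (M.parallelClass S i).card + M.rank S = M.rank (insert i S) := by
  have h₁ := M.rank_insert_le S i
  have h₂ := M.rank_mono (Finset.subset_insert i S)
  unfold parallelClass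
  split_ifs with h
  · simp [h]
  · simp only [Finset.card_singleton]
    omega

theorem card_parallelClass_union_add_rank (S : Finset (Fin n)) (i j : Fin n) :
    (M.parallelClass S i ∪ M.parallelClass S j).card + M.rank S =
      M.rank (insert i (insert j S)) := by
  have hi := M.card_parallelClass_add_rank S i
  have hj := M.card_parallelClass_add_rank S j
  by_cases h₁ : M.rank (insert i S) = M.rank S
  · rw [M.rank_insert_eq_of_subset (Finset.subset_insert j S) h₁, ← hj]
    simp [parallelClass, h₁]
  by_cases h₂ : M.rank (insert j S) = M.rank S
  · rw [Finset.insert_comm, M.rank_insert_eq_of_subset (Finset.subset_insert i S) h₂, ← hi]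
    simp [parallelClass, h₂]
  have hij : M.rank (insert i S) = M.rank (insert j S) := by
    rw [← hi, ← hj]
    simp [parallelClass, h₁, h₂]
  by_cases hc : M.closure (insert i S) = M.closure (insert j S)
  · rw [(M.closure_insert_eq_iff hij).mp hc, ← hj]
    simp [parallelClass, h₁, h₂, hc]
  · have hne := mt (M.closure_insert_eq_iff hij).mpr hc
    have h₃ := M.rank_insert_le (insert j S) i
    have h₄ := M.rank_mono (Finset.subset_insert i (insert j S))
    have hcard : (M.parallelClass S i ∪ M.parallelClass S j).card = 2 := by
      simp only [parallelClass, if_neg h₁, if_neg h₂]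
      exact Finset.card_pair hc
    have hj₁ : (M.parallelClass S j).card = 1 := by simp [parallelClass, h₂]
    omega

end FinMatroid

/-- The cardinality of a union of a family of finite sets is a coverage function. -/
theorem isCoverageOn_card_biUnion {n : ℕ} {α : Type*} [Fintype α] [DecidableEq α]
    (V : Finset (Fin n)) (A : Fin n → Finset α) :
    IsCoverageOn V fun T => ((T.biUnion A).card : ℝ) := by
  let e := Fintype.equivFin α
  refine ⟨Fintype.card α, fun _ => 1, fun i => (A i).map e.toEmbedding,
    fun _ => zero_le_one, fun T _ => ?_⟩
  have h : T.biUnion (fun i => (A i).map e.toEmbedding) = (T.biUnion A).map e.toEmbedding := by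
    simp only [Finset.map_eq_image, Finset.biUnion_image]
  simp [h]

/-- The rank function of any matroid on `[n]` is strongly 2-coverage. -/
theorem stmt_14 {n : ℕ} (M : FinMatroid n) :
    StronglyTwoCoverage (fun S => (M.rank S : ℝ)) := by
  intro τ _
  refine ⟨_, isCoverageOn_card_biUnion (Finset.univ \ τ) (M.parallelClass τ),
    fun S _ hne hcard => ?_⟩
  have hpos := hne.card_pos
  obtain h | h : S.card = 1 ∨ S.card = 2 := by omega
  · obtain ⟨i, rfl⟩ := Finset.card_eq_one.mp h
    have := M.card_parallelClass_add_rank τ i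
    rw [Finset.union_comm, ← Finset.insert_eq]
    beta_reduce
    rw [← this]
    simp
  · obtain ⟨i, j, _, rfl⟩ := Finset.card_eq_two.mp h
    have := M.card_parallelClass_union_add_rank τ i j
    rw [Finset.union_comm, Finset.insert_union, ← Finset.insert_eq]
    beta_reduce
    rw [← this]
    simp [Finset.biUnion_insert]
end

section
/- Define weights on [12] by w_1 = w_2 = w_3 = w_4 = w_5 = w_6 = 1, w_7 = w_8 = w_9 = w_10 = 2, and w_11 = w_12 = 0, and let f : 2^{[12]} → ℝ_{≥0} be the budget-additive function f(S) = min{ Σ_{i∈S} w_i , 2 }. Then f is nonnegative, monotone, and submodular with f(∅) = 0, but the quadratic polynomial p(x) = Σ_{{i,j}⊆[12], i≠j} f({i,j}) x_i x_j (the generating polynomial of f^{(2)}) is not log-concave over ℝ^{12}_{≥0}. -/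
open MvPolynomial

/-- The weights `w₁ = ⋯ = w₆ = 1`, `w₇ = ⋯ = w₁₀ = 2`, `w₁₁ = w₁₂ = 0`
(0-indexed over `Fin 12`). -/
noncomputable def wBudget : Fin 12 → ℝ :=
  fun i => if i.val < 6 then 1 else if i.val < 10 then 2 else 0

/-- The budget-additive function `f S = min (∑_{i ∈ S} w_i) 2`. -/
noncomputable def fBudget : Finset (Fin 12) → ℝ :=
  fun S => min (∑ i ∈ S, wBudget i) 2

lemma wBudget_nonneg (i : Fin 12) : 0 ≤ wBudget i := by
  unfold wBudget
  split_ifs <;> norm_num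

lemma fBudget_nonneg (S : Finset (Fin 12)) : 0 ≤ fBudget S :=
  le_min (Finset.sum_nonneg fun i _ => wBudget_nonneg i) zero_le_two

lemma fBudget_monotone : MonotoneSet fBudget := fun _ _ h =>
  min_le_min_right _ (Finset.sum_le_sum_of_subset_of_nonneg h fun i _ _ => wBudget_nonneg i)

lemma fBudget_submodular : SubmodularSet fBudget := by
  intro S T hST i
  by_cases hT : i ∈ T
  · rw [Finset.insert_eq_of_mem hT, sub_self, sub_nonneg]
    exact fBudget_monotone (Finset.subset_insert i S)
  · have hS : i ∉ S := fun h => hT (hST h)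
    have hw := wBudget_nonneg i
    have hle : ∑ j ∈ S, wBudget j ≤ ∑ j ∈ T, wBudget j :=
      Finset.sum_le_sum_of_subset_of_nonneg hST fun j _ _ => wBudget_nonneg j
    simp only [fBudget, Finset.sum_insert hT, Finset.sum_insert hS]
    grind

lemma Finset.sum_powersetCard_two_univ {n : ℕ} {M : Type*} [AddCommMonoid M]
    (g : Finset (Fin n) → M) :
    ∑ S ∈ Finset.powersetCard 2 Finset.univ, g S =
      ∑ i, ∑ j, if i < j then g {i, j} else 0 := by
  rw [← Finset.sum_product', ← Finset.sum_filter]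
  symm
  refine Finset.sum_bij (fun p _ => {p.1, p.2}) ?_ ?_ ?_ fun _ _ => rfl
  · intro p hp
    simp only [Finset.mem_filter] at hp
    simp [Finset.mem_powersetCard, Finset.card_pair hp.2.ne]
  · rintro ⟨a, b⟩ hp ⟨c, d⟩ hq h
    simp only [Finset.mem_filter] at hp hq
    have ha : a ∈ ({c, d} : Finset (Fin n)) := h ▸ by simp
    have hb : b ∈ ({c, d} : Finset (Fin n)) := h ▸ by simp
    simp only [Finset.mem_insert, Finset.mem_singleton] at ha hb
    grind
  · intro S hS
    obtain ⟨a, b, hab, rfl⟩ := Finset.card_eq_two.mp (Finset.mem_powersetCard.mp hS).2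
    rcases hab.lt_or_gt with h | h
    · exact ⟨(a, b), by simpa using h, rfl⟩
    · exact ⟨(b, a), by simpa using h, Finset.pair_comm b a⟩

lemma eval_genPoly_homRestrict_two {n : ℕ} (f : Finset (Fin n) → ℝ) (x : Fin n → ℝ) :
    eval x (genPoly (homRestrict f 2)) =
      ∑ i, ∑ j, if i < j then f {i, j} * (x i * x j) else 0 := by
  have h : eval x (genPoly (homRestrict f 2)) =
      ∑ S ∈ Finset.powersetCard 2 Finset.univ, f S * ∏ i ∈ S, x i := by
    rw [Finset.powersetCard_eq_filter, Finset.powerset_univ, Finset.sum_filter]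
    simp [genPoly, homRestrict, map_prod]
  rw [h, Finset.sum_powersetCard_two_univ]
  refine Finset.sum_congr rfl fun i _ => Finset.sum_congr rfl fun j _ => ?_
  split_ifs with hij
  · rw [Finset.prod_pair hij.ne]
  · rfl

/-- The vector taking the values `a`, `b`, `c` at the indices of weight `1`, `2`, `0`. -/
def blockVec (a b c : ℝ) : Fin 12 → ℝ := ![a, a, a, a, a, a, b, b, b, b, c, c]

lemma blockVec_nonneg {a b c : ℝ} (ha : 0 ≤ a) (hb : 0 ≤ b) (hc : 0 ≤ c) (i : Fin 12) :
    0 ≤ blockVec a b c i := by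
  fin_cases i <;> assumption

lemma fBudget_pair {i j : Fin 12} (h : i < j) :
    fBudget {i, j} = min (wBudget i + wBudget j) 2 := by
  rw [fBudget, Finset.sum_pair h.ne]

lemma wBudget_eq_blockVec : wBudget = blockVec 1 2 0 := by
  funext i
  fin_cases i <;> simp [wBudget, blockVec]

lemma eval_genPoly_blockVec (a b c : ℝ) :
    eval (blockVec a b c) (genPoly (homRestrict fBudget 2)) =
      30 * a ^ 2 + 48 * a * b + 12 * b ^ 2 + 12 * a * c + 16 * b * c := by
  have h : eval (blockVec a b c) (genPoly (homRestrict fBudget 2)) =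
      ∑ i, ∑ j, if i < j then
        min (wBudget i + wBudget j) 2 * (blockVec a b c i * blockVec a b c j) else 0 := by
    rw [eval_genPoly_homRestrict_two]
    refine Finset.sum_congr rfl fun i _ => Finset.sum_congr rfl fun j _ => ?_
    split_ifs with hij
    · rw [fBudget_pair hij]
    · rfl
  have h₁ : min (1 + 1 : ℝ) 2 = 2 := by norm_num
  rw [h, wBudget_eq_blockVec]
  simp [Fin.sum_univ_succ, blockVec, h₁]
  ring

lemma not_logConcaveOn_genPoly_fBudget : ¬ LogConcaveOn (genPoly (homRestrict fBudget 2)) := by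
  rintro ⟨-, h⟩
  have hlc := h (blockVec 0 4 15) (blockVec 6 0 1)
    (blockVec_nonneg (by norm_num) (by norm_num) (by norm_num))
    (blockVec_nonneg (by norm_num) (by norm_num) (by norm_num)) (1 / 2) (by norm_num) (by norm_num)
  have hmid : (fun i => 1 / 2 * blockVec 0 4 15 i + (1 - 1 / 2) * blockVec 6 0 1 i) =
      blockVec 3 2 8 := by
    funext i
    fin_cases i <;> norm_num [blockVec]
  rw [hmid, eval_genPoly_blockVec, eval_genPoly_blockVec, eval_genPoly_blockVec] at hlc
  norm_num at hlc
  rw [← Real.rpow_add (by norm_num)] at hlc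
  norm_num at hlc

/-- `fBudget` is nonnegative, monotone and submodular with `f ∅ = 0`,
but the generating polynomial of its 2-homogeneous restriction is not log-concave. -/
theorem stmt_16 :
    (∀ S, 0 ≤ fBudget S) ∧ MonotoneSet fBudget ∧ SubmodularSet fBudget ∧
      fBudget ∅ = 0 ∧ ¬ LogConcaveOn (genPoly (homRestrict fBudget 2)) := by
  exact ⟨fBudget_nonneg, fBudget_monotone, fBudget_submodular, by simp [fBudget],
    not_logConcaveOn_genPoly_fBudget⟩
end

section
/- There exist an integer n ≥ 1 and a nonnegative monotone submodular set function f : 2^{[n]} → ℝ_{≥0} with f(∅) = 0 such that the generating polynomial p_f(z_1,…,z_n) = Σ_{S⊆[n]} f(S) Π_{i∈S} z_i is not log-concave over ℝ^n_{≥0}. -/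
open MvPolynomial

/-- The number of elements of `S` among the first five points of `Fin 10`. -/
def lowCard (S : Finset (Fin 10)) : ℕ := (S.filter fun i => i < 5).card

/-- The number of elements of `S` among the last five points of `Fin 10`. -/
def highCard (S : Finset (Fin 10)) : ℕ := (S.filter fun i => ¬ i < 5).card

/-- The value on a set with `a` low points and `b` high points. -/
noncomputable def blockValue (a b : ℕ) : ℝ :=
  if a + b = 0 then 0 else if a + b = 1 then 1 else if a = 1 ∧ b = 1 then 3 / 2 else 2

/-- A monotone submodular function on `Fin 10` depending only on the block counts. -/
noncomputable def blockFun (S : Finset (Fin 10)) : ℝ := blockValue (lowCard S) (highCard S)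

theorem blockValue_mono {a b c d : ℕ} (hac : a ≤ c) (hbd : b ≤ d) :
    blockValue a b ≤ blockValue c d := by
  unfold blockValue
  split_ifs <;> first | omega | norm_num

theorem blockValue_diff_left {a b c d : ℕ} (hac : a ≤ c) (hbd : b ≤ d) :
    blockValue (c + 1) d - blockValue c d ≤ blockValue (a + 1) b - blockValue a b := by
  unfold blockValue
  split_ifs <;> first | omega | norm_num

theorem blockValue_comm (a b : ℕ) : blockValue a b = blockValue b a := by
  simp only [blockValue, add_comm a b, and_comm]

theorem lowCard_mono {S T : Finset (Fin 10)} (h : S ⊆ T) : lowCard S ≤ lowCard T :=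
  Finset.card_le_card (Finset.filter_subset_filter _ h)

theorem highCard_mono {S T : Finset (Fin 10)} (h : S ⊆ T) : highCard S ≤ highCard T :=
  Finset.card_le_card (Finset.filter_subset_filter _ h)

theorem blockFun_empty : blockFun ∅ = 0 := by
  simp [blockFun, blockValue, lowCard, highCard]

theorem blockFun_mono : MonotoneSet blockFun := fun _ _ h =>
  blockValue_mono (lowCard_mono h) (highCard_mono h)

theorem blockFun_insert_low {S : Finset (Fin 10)} {i : Fin 10} (hS : i ∉ S) (hi : i < 5) :
    blockFun (insert i S) = blockValue (lowCard S + 1) (highCard S) := by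
  unfold blockFun lowCard highCard
  rw [Finset.filter_insert, Finset.filter_insert, if_pos hi, if_neg (not_not.mpr hi),
    Finset.card_insert_of_notMem (by simp [hS])]

theorem blockFun_insert_high {S : Finset (Fin 10)} {i : Fin 10} (hS : i ∉ S) (hi : ¬ i < 5) :
    blockFun (insert i S) = blockValue (lowCard S) (highCard S + 1) := by
  unfold blockFun lowCard highCard
  rw [Finset.filter_insert, Finset.filter_insert, if_neg hi, if_pos hi,
    Finset.card_insert_of_notMem (by simp [hS])]

theorem blockFun_submodular : SubmodularSet blockFun := by
  intro S T h i
  by_cases hT : i ∈ T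
  · rw [Finset.insert_eq_of_mem hT, sub_self, sub_nonneg]
    exact blockFun_mono (Finset.subset_insert i S)
  have hS : i ∉ S := fun hS => hT (h hS)
  by_cases hi : i < 5
  · rw [blockFun_insert_low hS hi, blockFun_insert_low hT hi]
    exact blockValue_diff_left (lowCard_mono h) (highCard_mono h)
  · rw [blockFun_insert_high hS hi, blockFun_insert_high hT hi]
    unfold blockFun
    simp only [blockValue_comm (lowCard _)]
    exact blockValue_diff_left (highCard_mono h) (lowCard_mono h)

/-- The pairs with one low and one high point. -/
def crossPairs : Finset (Finset (Fin 10)) :=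
  Finset.univ.filter fun S => lowCard S = 1 ∧ highCard S = 1

theorem card_eq_lowCard_add_highCard (S : Finset (Fin 10)) :
    S.card = lowCard S + highCard S :=
  (Finset.card_filter_add_card_filter_not _).symm

theorem card_crossPairs : crossPairs.card = 25 := by
  let low : Finset (Fin 10) := Finset.univ.filter fun i => i < 5
  let high : Finset (Fin 10) := Finset.univ.filter fun i => ¬ i < 5
  have hcard : (low.powersetCard 1 ×ˢ high.powersetCard 1).card = 25 := by
    rw [Finset.card_product, Finset.card_powersetCard, Finset.card_powersetCard,
      show low.card = 5 by decide, show high.card = 5 by decide]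
    norm_num
  rw [← hcard]
  refine Finset.card_nbij' (fun S => (S.filter fun i => i < 5, S.filter fun i => ¬ i < 5))
    (fun P => P.1 ∪ P.2) ?_ ?_ ?_ ?_
  · intro S hS
    obtain ⟨-, h₁, h₂⟩ := Finset.mem_filter.mp hS
    exact Finset.mem_product.mpr
      ⟨Finset.mem_powersetCard.mpr ⟨Finset.filter_subset_filter _ (Finset.subset_univ S), h₁⟩,
        Finset.mem_powersetCard.mpr ⟨Finset.filter_subset_filter _ (Finset.subset_univ S), h₂⟩⟩
  all_goals rintro P hP
  · obtain ⟨hA, hB⟩ := Finset.mem_product.mp hP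
    obtain ⟨hA, hA'⟩ := Finset.mem_powersetCard.mp hA
    obtain ⟨hB, hB'⟩ := Finset.mem_powersetCard.mp hB
    refine Finset.mem_filter.mpr ⟨Finset.mem_univ _, ?_, ?_⟩
    · rw [← hA', lowCard]
      congr 1
      grind
    · rw [← hB', highCard]
      congr 1
      grind
  · exact Finset.filter_union_filter_not_eq _ P
  · obtain ⟨hA, hB⟩ := Finset.mem_product.mp hP
    have hA := (Finset.mem_powersetCard.mp hA).1
    have hB := (Finset.mem_powersetCard.mp hB).1
    ext1
    · ext i
      grind
    · ext i
      grind

theorem blockFun_eq (S : Finset (Fin 10)) :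
    blockFun S = 2 - (if S ∈ Finset.powersetCard 0 Finset.univ then 2 else 0)
      - (if S ∈ Finset.powersetCard 1 Finset.univ then 1 else 0)
      - (if S ∈ crossPairs then 1 / 2 else 0) := by
  simp only [blockFun, blockValue, Finset.mem_powersetCard_univ, crossPairs, Finset.mem_filter,
    Finset.mem_univ, true_and, card_eq_lowCard_add_highCard]
  split_ifs <;> first | omega | norm_num

theorem eval_genPoly_blockFun (x : Fin 10 → ℝ) :
    MvPolynomial.eval x (genPoly blockFun) =
      2 * ∏ i, (1 + x i) - 2 - ∑ i, x i - 1 / 2 * ∑ S ∈ crossPairs, ∏ i ∈ S, x i := by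
  simp only [genPoly, map_sum, map_mul, map_prod, MvPolynomial.eval_C, MvPolynomial.eval_X,
    blockFun_eq, sub_mul, Finset.sum_sub_distrib, ite_mul, zero_mul, Finset.sum_ite_mem,
    Finset.univ_inter, Finset.prod_one_add, Finset.powerset_univ, Finset.mul_sum]
  simp [Finset.powersetCard_one]

theorem eval_genPoly_blockFun_const (s : ℝ) :
    MvPolynomial.eval (fun _ => s) (genPoly blockFun) =
      2 * (1 + s) ^ 10 - 2 - 10 * s - 25 / 2 * s ^ 2 := by
  have h : ∑ S ∈ crossPairs, ∏ _i ∈ S, s = 25 * s ^ 2 := by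
    rw [Finset.sum_congr rfl (g := fun _ => s ^ 2), Finset.sum_const, card_crossPairs]
    · simp
    · intro S hS
      have := (Finset.mem_filter.mp hS).2
      rw [Finset.prod_const, card_eq_lowCard_add_highCard, this.1, this.2]
  rw [eval_genPoly_blockFun, h]
  simp
  ring

theorem eval_genPoly_blockFun_low (s : ℝ) :
    MvPolynomial.eval (fun i : Fin 10 => if i < 5 then s else 0) (genPoly blockFun) =
      2 * (1 + s) ^ 5 - 2 - 5 * s := by
  have h : ∑ S ∈ crossPairs, ∏ i ∈ S, (if i < 5 then s else 0) = 0 := by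
    refine Finset.sum_eq_zero fun S hS => ?_
    obtain ⟨i, hi⟩ := Finset.card_pos.mp
      (show 0 < highCard S by rw [(Finset.mem_filter.mp hS).2.2]; norm_num)
    obtain ⟨hiS, hi⟩ := Finset.mem_filter.mp hi
    exact Finset.prod_eq_zero hiS (if_neg hi)
  rw [eval_genPoly_blockFun, h]
  simp [Fin.prod_univ_succ, Fin.sum_univ_succ, Fin.lt_def]
  ring

theorem eval_genPoly_blockFun_high (s : ℝ) :
    MvPolynomial.eval (fun i : Fin 10 => if i < 5 then 0 else s) (genPoly blockFun) =
      2 * (1 + s) ^ 5 - 2 - 5 * s := by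
  have h : ∑ S ∈ crossPairs, ∏ i ∈ S, (if i < 5 then 0 else s) = 0 := by
    refine Finset.sum_eq_zero fun S hS => ?_
    obtain ⟨i, hi⟩ := Finset.card_pos.mp
      (show 0 < lowCard S by rw [(Finset.mem_filter.mp hS).2.1]; norm_num)
    obtain ⟨hiS, hi⟩ := Finset.mem_filter.mp hi
    exact Finset.prod_eq_zero hiS (if_pos hi)
  rw [eval_genPoly_blockFun, h]
  simp [Fin.prod_univ_succ, Fin.sum_univ_succ, Fin.lt_def]
  ring

theorem not_logConcaveOn_genPoly_blockFun : ¬ LogConcaveOn (genPoly blockFun) := by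
  rintro ⟨-, h⟩
  have key := h (fun i => if i < 5 then 1 / 50 else 0) (fun i => if i < 5 then 0 else 1 / 50)
    (fun i => by split_ifs <;> norm_num)
    (fun i => by split_ifs <;> norm_num) (1 / 2) (by norm_num) (by norm_num)
  have hmid : (fun i : Fin 10 => (1 / 2 : ℝ) * (if i < 5 then 1 / 50 else 0) +
      (1 - 1 / 2) * (if i < 5 then 0 else 1 / 50)) = fun _ => 1 / 100 := by
    funext i
    split_ifs <;> norm_num
  rw [hmid, eval_genPoly_blockFun_low, eval_genPoly_blockFun_high, eval_genPoly_blockFun_const,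
    ← Real.rpow_add (by norm_num), add_sub_cancel, Real.rpow_one] at key
  norm_num at key

/-- There exist `n ≥ 1` and a nonnegative monotone submodular set function
`f` on `[n]` with `f ∅ = 0` whose generating polynomial is not log-concave. -/
theorem stmt_17 :
    ∃ (n : ℕ) (f : Finset (Fin n) → ℝ), 1 ≤ n ∧ (∀ S, 0 ≤ f S) ∧ f ∅ = 0 ∧
      MonotoneSet f ∧ SubmodularSet f ∧ ¬ LogConcaveOn (genPoly f) := by
  exact ⟨10, blockFun, by norm_num,
    fun S => blockFun_empty.symm.trans_le (blockFun_mono (Finset.empty_subset S)),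
    blockFun_empty, blockFun_mono, blockFun_submodular, not_logConcaveOn_genPoly_blockFun⟩
end

section
/- If p ∈ ℝ[z_1,…,z_n] is a multiaffine polynomial that is log-concave over ℝ^n_{≥0}, then for every 1 ≤ i ≤ n the partial derivative ∂_{z_i} p is log-concave over ℝ^n_{≥0}. -/
open MvPolynomial

open Filter Topology in
theorem tendsto_mul_add_div_atTop (a b : ℝ) :
    Tendsto (fun s : ℝ => (s * a + b) / s) atTop (𝓝 a) := by
  have h : Tendsto (fun s : ℝ => a + b / s) atTop (𝓝 (a + 0)) :=
    tendsto_const_nhds.add (tendsto_const_nhds.div_atTop tendsto_id)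
  rw [add_zero] at h
  refine h.congr' ?_
  filter_upwards [eventually_gt_atTop 0] with s hs
  field_simp

theorem eval_update_monomial {σ : Type*} [Fintype σ] [DecidableEq σ] (m : σ →₀ ℕ) (c : ℝ)
    (i : σ) (hm : m i ≤ 1) (x : σ → ℝ) (s : ℝ) :
    eval (Function.update x i s) (monomial m c) =
      s * eval x (pderiv i (monomial m c)) + eval (Function.update x i 0) (monomial m c) := by
  have hprod (f : σ → ℝ) (k : σ →₀ ℕ) :
      k.prod (fun j e => f j ^ e) = f i ^ k i * ∏ j ∈ Finset.univ.erase i, f j ^ k j := by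
    rw [Finsupp.prod_fintype _ _ (by simp),
      Finset.mul_prod_erase _ (fun j => f j ^ k j) (Finset.mem_univ i)]
  have hupd (u : ℝ) : ∏ j ∈ Finset.univ.erase i, Function.update x i u j ^ m j =
      ∏ j ∈ Finset.univ.erase i, x j ^ m j :=
    Finset.prod_congr rfl fun j hj => by
      rw [Function.update_of_ne (Finset.ne_of_mem_erase hj)]
  have hsub : ∏ j ∈ Finset.univ.erase i, x j ^ (m - Finsupp.single i 1 : σ →₀ ℕ) j =
      ∏ j ∈ Finset.univ.erase i, x j ^ m j :=
    Finset.prod_congr rfl fun j hj => by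
      simp [Finsupp.single_eq_of_ne (Finset.ne_of_mem_erase hj)]
  simp only [pderiv_monomial, eval_monomial, hprod, hupd, hsub, Function.update_self]
  interval_cases h : m i <;> simp [h]
  ring

/-- A polynomial of degree at most one in `z i` is affine in `z i`, with slope `∂_{z i} p`. -/
theorem eval_update_eq_mul_eval_pderiv_add {σ : Type*} [Fintype σ] [DecidableEq σ]
    (p : MvPolynomial σ ℝ) (i : σ) (hp : ∀ m ∈ p.support, m i ≤ 1) (x : σ → ℝ) (s : ℝ) :
    eval (Function.update x i s) p =
      s * eval x (pderiv i p) + eval (Function.update x i 0) p := by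
  rw [p.as_sum, map_sum (eval _), map_sum (pderiv i), map_sum (eval _), map_sum (eval _),
    Finset.mul_sum]
  rw [← Finset.sum_add_distrib]
  exact Finset.sum_congr rfl fun m hm => eval_update_monomial m _ i (hp m hm) x s

open Filter Topology in
theorem tendsto_eval_update_div {σ : Type*} [Fintype σ] [DecidableEq σ]
    (p : MvPolynomial σ ℝ) (i : σ) (hp : ∀ m ∈ p.support, m i ≤ 1) (x : σ → ℝ) :
    Tendsto (fun s : ℝ => eval (Function.update x i s) p / s) atTop
      (𝓝 (eval x (pderiv i p))) := by
  refine (tendsto_mul_add_div_atTop _ (eval (Function.update x i 0) p)).congr fun s => ?_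
  rw [← eval_update_eq_mul_eval_pderiv_add p i hp x s]

/-- Partial derivatives of multiaffine log-concave polynomials are
log-concave. -/
theorem stmt_19 {n : ℕ} (p : MvPolynomial (Fin n) ℝ)
    (hma : ∀ m ∈ p.support, ∀ i, m i ≤ 1)
    (h : LogConcaveOn p) (i : Fin n) :
    LogConcaveOn (MvPolynomial.pderiv i p) := by
  have hp : ∀ m ∈ p.support, m i ≤ 1 := fun m hm => hma m hm i
  have hupd (x : Fin n → ℝ) (hx : ∀ j, 0 ≤ x j) (s : ℝ) (hs : 0 < s) (j : Fin n) :
      0 ≤ Function.update x i s j := by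
    rcases eq_or_ne j i with rfl | hj
    · simpa using hs.le
    · simpa [hj] using hx j
  refine ⟨fun x hx => ?_, fun x y hx hy t ht0 ht1 => ?_⟩
  · refine ge_of_tendsto (tendsto_eval_update_div p i hp x) ?_
    filter_upwards [Filter.eventually_gt_atTop 0] with s hs
    exact div_nonneg (h.1 _ (hupd x hx s hs)) hs.le
  · have ht1' : 0 ≤ 1 - t := sub_nonneg.2 ht1
    refine le_of_tendsto_of_tendsto
      (((tendsto_eval_update_div p i hp x).rpow_const (Or.inr ht0)).mul
        ((tendsto_eval_update_div p i hp y).rpow_const (Or.inr ht1')))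
      (tendsto_eval_update_div p i hp _) ?_
    filter_upwards [Filter.eventually_gt_atTop 0] with s hs
    have hconv : (fun j => t * Function.update x i s j + (1 - t) * Function.update y i s j) =
        Function.update (fun j => t * x j + (1 - t) * y j) i s := by
      ext j
      rcases eq_or_ne j i with rfl | hj
      · simp only [Function.update_self]
        ring
      · simp [hj]
    have key := h.2 _ _ (hupd x hx s hs) (hupd y hy s hs) t ht0 ht1
    rw [hconv] at key
    rw [Real.div_rpow (h.1 _ (hupd x hx s hs)) hs.le,
      Real.div_rpow (h.1 _ (hupd y hy s hs)) hs.le, div_mul_div_comm, ← Real.rpow_add hs,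
      add_sub_cancel, Real.rpow_one]
    gcongr
end
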